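/- arXiv:2406.16669 — 5 statements merged into one kernel-verified Lean document; each statement's English description precedes it below -/
import Mathlib

section
/- Let n ≥ 1 and let ℍ₁ = (H₁,R₁), …, ℍₙ = (Hₙ,Rₙ) be partial semilattices with largest elements 1₁, …, 1ₙ respectively. Let ℍ = (H,R) be a partial semilattice and let f be a homomorphism from the product ternary structure ℍ₁ × ⋯ × ℍₙ to ℍ. For each i, let fᵢ : Hᵢ → H be the unary map fᵢ(x) = f(1₁, …, 1ᵢ₋₁, x, 1ᵢ₊₁, …, 1ₙ). Then (a) each fᵢ is a homomorphism from ℍᵢ to ℍ, and (b) for every (x₁,…,xₙ) ∈ H₁ × ⋯ × Hₙ the left-associated iterated meet ⨅ᵢ₌₁ⁿ fᵢ(xᵢ) exists in ℍ and equals f(x₁,…,xₙ); that is, there exist c₁, …, cₙ ∈ H with c₁ = f₁(x₁), (cⱼ, fⱼ₊₁(xⱼ₊₁), cⱼ₊₁) ∈ R for all 1 ≤ j < n, and cₙ = f(x₁,…,xₙ). -/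
universe u v

/-- A homomorphism of ternary structures. -/
def IsHom {G : Type u} {K : Type v} (R : G → G → G → Prop) (S : K → K → K → Prop)
    (f : G → K) : Prop :=
  ∀ a b c, R a b c → S (f a) (f b) (f c)

/-- A witness that `(G, R)` is a partial semilattice: a meet-semilattice `L` together with
an injective map `i : G → L` such that `i c = i a ⊓ i b` whenever `R a b c`. -/
structure PartialSemilatticeWitness {G : Type u} (R : G → G → G → Prop) where
  L : Type u
  [inst : SemilatticeInf L]
  emb : G → L
  inj : Function.Injective emb
  meet : ∀ a b c, R a b c → emb c = emb a ⊓ emb b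

/-- `(G, R)` is a partial semilattice: `R` is reflexive and there is a meet-semilattice
witness. -/
def IsPartialSemilattice {G : Type u} (R : G → G → G → Prop) : Prop :=
  (∀ a, R a a a) ∧ Nonempty (PartialSemilatticeWitness R)

/-- `one` is a largest element of the ternary structure `(G, R)`. -/
def IsLargest {G : Type u} (R : G → G → G → Prop) (one : G) : Prop :=
  ∀ a, R a one a ∧ R one a a

/-- The product of a family of ternary structures. -/
def PiRel {I : Type v} {G : I → Type u} (R : ∀ i, G i → G i → G i → Prop) :
    (∀ i, G i) → (∀ i, G i) → (∀ i, G i) → Prop :=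
  fun f g h => ∀ i, R i (f i) (g i) (h i)

/-- Let `ℍ₁, …, ℍₙ` (`n ≥ 1`) be partial semilattices with largest elements `1₁, …, 1ₙ`,
let `ℍ` be a partial semilattice and `f` a homomorphism from the product to `ℍ`.
Then each unary map `fᵢ(x) = f(1₁,…,x,…,1ₙ)` is a homomorphism `ℍᵢ → ℍ`, and for every
tuple `x` the left-associated iterated meet `⨅ᵢ fᵢ(xᵢ)` exists in `ℍ` and equals `f x`. -/
theorem stmt0 {n : ℕ} (hn : 1 ≤ n)
    {H : Fin n → Type u} (R : ∀ i, H i → H i → H i → Prop)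
    (hps : ∀ i, IsPartialSemilattice (R i))
    (one : ∀ i, H i) (hone : ∀ i, IsLargest (R i) (one i))
    {K : Type v} (S : K → K → K → Prop) (hK : IsPartialSemilattice S)
    (f : (∀ i, H i) → K) (hf : IsHom (PiRel R) S f) :
    (∀ i : Fin n, IsHom (R i) S (fun x => f (Function.update one i x))) ∧
    (∀ x : ∀ i, H i, ∃ c : Fin n → K,
      c ⟨0, hn⟩ = f (Function.update one ⟨0, hn⟩ (x ⟨0, hn⟩)) ∧
      (∀ (j : ℕ) (hj : j + 1 < n),
        S (c ⟨j, by omega⟩)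
          (f (Function.update one ⟨j + 1, hj⟩ (x ⟨j + 1, hj⟩)))
          (c ⟨j + 1, hj⟩)) ∧
      c ⟨n - 1, by omega⟩ = f x) := by
  refine ⟨fun i a b c h => hf _ _ _ fun k => ?_, fun x =>
    ⟨fun j => f (fun i => if i ≤ j then x i else one i), ?_, fun j hj => hf _ _ _ fun k => ?_, ?_⟩⟩
  · rcases eq_or_ne k i with rfl | hk
    · simpa using h
    · simpa [hk] using (hps k).1 (one k)
  · refine congrArg f (funext fun k => ?_)
    rcases eq_or_ne k ⟨0, hn⟩ with rfl | hk
    · simp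
    · have hle : ¬ k ≤ ⟨0, hn⟩ := fun h => hk (le_antisymm h (Nat.zero_le _))
      simp [hk, hle]
  · rcases eq_or_ne k ⟨j + 1, hj⟩ with rfl | hk
    · simpa [Fin.le_def] using (hone _ (x _)).2
    · have hiff : k ≤ ⟨j + 1, hj⟩ ↔ k ≤ ⟨j, by omega⟩ := by
        simp only [Fin.le_def, ne_eq, Fin.ext_iff] at hk ⊢
        omega
      simpa only [Function.update_of_ne hk, hiff] using (hone k _).1
  · refine congrArg f (funext fun k => if_pos ?_)
    simp only [Fin.le_def]
    omega
end

section
/- Let 𝕊 be the ternary structure on {0,1} whose relation is {(0,0,0), (0,1,0), (1,0,0), (1,1,1)}. For every n ≥ 1, a map f : {0,1}ⁿ → {0,1} is an n-ary polymorphism of 𝕊 if and only if either f is a constant map, or there is a nonempty subset I ⊆ {1,…,n} such that f(x₁,…,xₙ) = ⋀_{i∈I} xᵢ for all x₁,…,xₙ ∈ {0,1} (where ⋀ is the meet of the two-element meet semilattice 0 < 1). -/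
universe u

/-- The ternary relation of the two-element semilattice structure `𝕊` on `{0,1}`
(encoded as `Bool`, with `false = 0`, `true = 1`): the graph of the meet operation,
i.e. the set of triples `{(0,0,0), (0,1,0), (1,0,0), (1,1,1)}`. -/
def SRel : Bool → Bool → Bool → Prop := fun a b c => c = (a && b)

/-- A map into `Bool` which preserves binary meets and `⊤` is the indicator function of a
principal filter, when its domain is finite. -/
theorem exists_forall_eq_true_iff_le {α : Type*} [SemilatticeInf α] [OrderTop α] [Fintype α]
    (f : α → Bool) (hinf : ∀ a b, f (a ⊓ b) = (f a && f b)) (htop : f ⊤ = true) :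
    ∃ m, ∀ x, f x = true ↔ m ≤ x := by
  let s : Finset α := {x | f x = true}
  have hm : f (s.inf id) = true :=
    Finset.inf_induction (p := fun x => f x = true) htop
      (fun a ha b hb => by simp [hinf, ha, hb]) (fun b hb => by simpa [s] using hb)
  refine ⟨s.inf id, fun x => ⟨fun hx => Finset.inf_le (f := id) (by simpa [s] using hx),
    fun hx => ?_⟩⟩
  have h := hinf (s.inf id) x
  rw [inf_eq_left.mpr hx, hm] at h
  simpa using h.symm

/-- A meet over a nonempty finite set is `true` iff all its terms are. -/
theorem Finset.inf'_bool_eq_true_iff {ι : Type*} {s : Finset ι} (hs : s.Nonempty)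
    (x : ι → Bool) : (s.inf' hs fun i => x i) = true ↔ ∀ i ∈ s, x i = true := by
  have h : ∀ b : Bool, b = true ↔ true ≤ b := by decide
  simp only [h, Finset.le_inf'_iff]

/-- A map `f : {0,1}ⁿ → {0,1}` (`n ≥ 1`) is an `n`-ary polymorphism of `𝕊` iff it is
constant or it is the meet `⋀_{i ∈ I} xᵢ` over some nonempty set `I` of coordinates. -/
theorem stmt1 {n : ℕ} (hn : 1 ≤ n) (f : (Fin n → Bool) → Bool) :
    (∀ a b c : Fin n → Bool, (∀ j, SRel (a j) (b j) (c j)) → SRel (f a) (f b) (f c)) ↔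
      ((∃ k : Bool, ∀ x, f x = k) ∨
        (∃ (I : Finset (Fin n)) (hI : I.Nonempty),
          ∀ x : Fin n → Bool, f x = I.inf' hI fun i => x i)) := by
  constructor
  · intro hf
    have hinf : ∀ a b, f (a ⊓ b) = (f a && f b) := fun a b => hf a b (a ⊓ b) fun _ => rfl
    by_cases htop : f ⊤ = true
    · obtain ⟨m, hm⟩ := exists_forall_eq_true_iff_le f hinf htop
      have hle : ∀ x, m ≤ x ↔ ∀ i, m i = true → x i = true := fun _ => Iff.rfl
      by_cases hI : ({i | m i = true} : Finset (Fin n)).Nonempty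
      · refine Or.inr ⟨_, hI, fun x => ?_⟩
        rw [Bool.eq_iff_iff, Finset.inf'_bool_eq_true_iff, hm, hle]
        simp
      · refine Or.inl ⟨true, fun x => (hm x).mpr ((hle x).mpr fun i hi => ?_)⟩
        exact absurd ⟨i, by simpa using hi⟩ hI
    · refine Or.inl ⟨false, fun x => ?_⟩
      have h := hinf x ⊤
      rwa [inf_top_eq, Bool.eq_false_iff.mpr htop, Bool.and_false] at h
  · rintro (⟨k, hk⟩ | ⟨I, hI, hf⟩) a b c h
    · simp [SRel, hk]
    · have hc : c = fun j => a j && b j := funext h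
      rw [SRel, Bool.eq_iff_iff]
      simp only [hf, hc, Bool.and_eq_true, Finset.inf'_bool_eq_true_iff, forall₂_and]
end

section
/- Let ℍ = (H,R) be a ternary structure with H finite, R reflexive, and ℍ connected. Then for every index set I, the power ℍ^I is reflexive and connected. -/
universe u v

/-- The union of the three binary projections of a ternary relation `R`:
`R₁₂ ∪ R₁₃ ∪ R₂₃`. -/
def LinkRel {G : Type u} (R : G → G → G → Prop) : G → G → Prop :=
  fun a b => (∃ c, R a b c) ∨ (∃ c, R a c b) ∨ (∃ c, R c a b)

/-- A ternary structure `(G, R)` is connected if the reflexive–symmetric–transitive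
closure of the union of its binary projections is the full relation on `G`. -/
def TernaryConnected {G : Type u} (R : G → G → G → Prop) : Prop :=
  ∀ a b, Relation.EqvGen (LinkRel R) a b

/-- The `I`-th power of a ternary structure, with the relation taken coordinatewise. -/
def PowRel (I : Type v) {G : Type u} (R : G → G → G → Prop) :
    (I → G) → (I → G) → (I → G) → Prop :=
  fun f g h => ∀ i, R (f i) (g i) (h i)

/-- In a power of a reflexive structure, an element may be moved from the value `a` to a value `b`
in the same component simultaneously on any set of coordinates. -/
theorem PowRel.eqvGen_piecewise {H : Type u} {R : H → H → H → Prop} (hrefl : ∀ a, R a a a)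
    {I : Type v} (S : Set I) [DecidablePred (· ∈ S)] (h : I → H) {a b : H}
    (hab : Relation.EqvGen (LinkRel R) a b) :
    Relation.EqvGen (LinkRel (PowRel I R)) (S.piecewise (fun _ => a) h)
      (S.piecewise (fun _ => b) h) := by
  have aux : ∀ x y z, R x y z → PowRel I R (S.piecewise (fun _ => x) h)
      (S.piecewise (fun _ => y) h) (S.piecewise (fun _ => z) h) := by
    intro x y z hR i
    by_cases hi : i ∈ S <;> simp [hi, hR, hrefl]
  induction hab with
  | rel x y hxy =>
    apply Relation.EqvGen.rel
    rcases hxy with ⟨c, hc⟩ | ⟨c, hc⟩ | ⟨c, hc⟩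
    · exact Or.inl ⟨_, aux _ _ _ hc⟩
    · exact Or.inr (Or.inl ⟨_, aux _ _ _ hc⟩)
    · exact Or.inr (Or.inr ⟨_, aux _ _ _ hc⟩)
  | refl x => exact .refl _
  | symm x y _ ih => exact .symm _ _ ih
  | trans x y z _ _ ih₁ ih₂ => exact .trans _ _ _ ih₁ ih₂

/-- If `ℍ = (H, R)` is a finite reflexive connected ternary structure, then for every
index set `I` the power `ℍ^I` is reflexive and connected. -/
theorem stmt6 {H : Type u} [Finite H] (R : H → H → H → Prop)
    (hrefl : ∀ a, R a a a) (hconn : TernaryConnected R) (I : Type v) :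
    (∀ f : I → H, PowRel I R f f f) ∧ TernaryConnected (PowRel I R) := by
  refine ⟨fun f i => hrefl (f i), fun f g => ?_⟩
  classical
  have := Fintype.ofFinite H
  have key : ∀ T : Finset (H × H), Relation.EqvGen (LinkRel (PowRel I R)) f
      (fun i => if (f i, g i) ∈ T then g i else f i) := by
    intro T
    induction T using Finset.induction_on with
    | empty => simpa using Relation.EqvGen.refl f
    | insert p T hp ih =>
      refine ih.trans _ _ _ ?_
      convert PowRel.eqvGen_piecewise hrefl {i | (f i, g i) = p}
        (fun i => if (f i, g i) ∈ T then g i else f i) (hconn p.1 p.2) using 1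
      · funext i
        by_cases hi : (f i, g i) = p
        · subst hi
          simp [hp]
        · simp [hi]
      · funext i
        by_cases hi : (f i, g i) = p
        · subst hi
          simp
        · simp [hi]
  simpa using key Finset.univ
end

section
/- The structure 𝕊 admits no Hobby–McKenzie polymorphism. Precisely: for every n ≥ 1 and every idempotent n-ary polymorphism f of 𝕊, there exists a nonempty subset I ⊆ {1,…,n} such that for every set V, all distinct elements x, y ∈ V, and all maps σ, τ : {1,…,n} → V satisfying σ(i) = x for all i ∈ I and τ(i₀) = y for some i₀ ∈ I, there exists an assignment e : V → {0,1} with f(e∘σ) ≠ f(e∘τ). -/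
universe u

/-- `𝕊` admits no Hobby–McKenzie polymorphism: for every idempotent `n`-ary polymorphism
`f` of `𝕊` (`n ≥ 1`) there is a nonempty set `I` of coordinates such that for every set
`V` of variables, all distinct `x, y ∈ V` and all `σ, τ : {1,…,n} → V` with `σ i = x` for
all `i ∈ I` and `τ i₀ = y` for some `i₀ ∈ I`, some assignment `e : V → {0,1}` separates
the two sides: `f (e ∘ σ) ≠ f (e ∘ τ)`. -/
theorem stmt9 {n : ℕ} (hn : 1 ≤ n) (f : (Fin n → Bool) → Bool)
    (hpoly : ∀ a b c : Fin n → Bool,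
      (∀ j, SRel (a j) (b j) (c j)) → SRel (f a) (f b) (f c))
    (hid : ∀ a : Bool, f (fun _ => a) = a) :
    ∃ I : Finset (Fin n), I.Nonempty ∧
      ∀ (V : Type u) (x y : V), x ≠ y →
        ∀ σ τ : Fin n → V, (∀ i ∈ I, σ i = x) → (∃ i ∈ I, τ i = y) →
          ∃ e : V → Bool, f (e ∘ σ) ≠ f (e ∘ τ) := by
  have hinf (a b : Fin n → Bool) : f (a ⊓ b) = (f a && f b) :=
    hpoly a b (a ⊓ b) fun _ => rfl
  -- `m` is the least tuple on which `f` is true; `f` is the meet of the coordinates where `m` is.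
  obtain ⟨m, hm, hle⟩ : ∃ m, f m = true ∧ ∀ a, f a = true → m ≤ a := by
    refine ⟨(Finset.univ.filter fun a => f a = true).inf id, ?_, fun a ha => ?_⟩
    · refine Finset.inf_induction (p := fun a => f a = true) (hid true) ?_ ?_
      · intro a ha b hb
        simp [hinf, ha, hb]
      · simp
    · exact Finset.inf_le (f := id) (by simpa using ha)
  refine ⟨Finset.univ.filter fun i => m i = true, ?_, ?_⟩
  · by_contra h
    have hm0 : m = fun _ => false := by
      ext i
      simpa using Finset.filter_eq_empty_iff.mp (Finset.not_nonempty_iff_eq_empty.mp h)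
        (Finset.mem_univ i)
    simp [hm0, hid] at hm
  · rintro V x y hxy σ τ hσ ⟨i₀, hi₀, hτ⟩
    classical
    refine ⟨fun v => decide (v ≠ y), fun heq => ?_⟩
    have hmσ : m ≤ (fun v => decide (v ≠ y)) ∘ σ := by
      intro i
      by_cases hi : m i = true
      · simp [hσ i (by simpa using hi), hxy]
      · simp [Bool.eq_false_iff.mpr hi]
    have hfσ : f ((fun v => decide (v ≠ y)) ∘ σ) = true := by
      have h := hinf m ((fun v => decide (v ≠ y)) ∘ σ)
      rw [inf_eq_left.mpr hmσ, hm] at h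
      simpa using h.symm
    have hτ₀ : m i₀ ≤ decide (τ i₀ ≠ y) := hle _ (heq ▸ hfσ) i₀
    simp only [Finset.mem_filter, Finset.mem_univ, true_and] at hi₀
    exact absurd (hτ₀ hi₀) (by simp [hτ])
end

section
/- Let U be a nonempty set and (H_u)_{u∈U} any family of sets. Then the disjoint union 𝔾 = ⊔_{u∈U} 𝕊^{H_u} admits a binary polymorphism f : G × G → G that is a semilattice operation on the base set G of 𝔾, i.e., f is idempotent (f(a,a) = a), commutative (f(a,b) = f(b,a)) and associative (f(f(a,b),c) = f(a,f(b,c))). -/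
universe u v

/-- The ternary relation of the disjoint union `⊔_{u ∈ U} 𝕊^{H u}`, whose base set is
`Σ u, H u → Bool`: a triple is in the relation iff all three entries lie in the same
component `𝕊^{H u}` and the relation of `𝕊` holds coordinatewise.  (For `H u` empty the
component is a one-element structure whose relation contains its constant triple.) -/
def DURel {U : Type u} {H : U → Type v} :
    (Σ u, H u → Bool) → (Σ u, H u → Bool) → (Σ u, H u → Bool) → Prop :=
  fun x y z => ∃ (u : U) (f g h : H u → Bool),
    x = ⟨u, f⟩ ∧ y = ⟨u, g⟩ ∧ z = ⟨u, h⟩ ∧ ∀ i, SRel (f i) (g i) (h i)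

/-- The ordinal sum of the semilattices `H u → Bool` over a linearly ordered index set:
two elements of the same component are met coordinatewise, and otherwise the one with
the smaller index is chosen. -/
def ordinalInf {U : Type u} [LinearOrder U] {H : U → Type v}
    (a b : Σ u, H u → Bool) : Σ u, H u → Bool :=
  if h : a.1 = b.1 then ⟨a.1, fun i => a.2 i && b.2 (h ▸ i)⟩
  else if a.1 < b.1 then a else b

section OrdinalInf

variable {U : Type u} [LinearOrder U] {H : U → Type v}

theorem ordinalInf_same (u : U) (f g : H u → Bool) :
    ordinalInf ⟨u, f⟩ ⟨u, g⟩ = ⟨u, fun i => f i && g i⟩ := by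
  simp [ordinalInf]

theorem ordinalInf_of_lt {u v : U} (h : u < v) (f : H u → Bool) (g : H v → Bool) :
    ordinalInf ⟨u, f⟩ ⟨v, g⟩ = ⟨u, f⟩ := by
  simp [ordinalInf, h, h.ne]

theorem ordinalInf_of_gt {u v : U} (h : v < u) (f : H u → Bool) (g : H v → Bool) :
    ordinalInf ⟨u, f⟩ ⟨v, g⟩ = ⟨v, g⟩ := by
  simp [ordinalInf, h.ne', h.not_gt]

theorem ordinalInf_self (a : Σ u, H u → Bool) : ordinalInf a a = a := by
  obtain ⟨u, f⟩ := a
  simp [ordinalInf_same]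

theorem ordinalInf_comm (a b : Σ u, H u → Bool) : ordinalInf a b = ordinalInf b a := by
  obtain ⟨u, f⟩ := a
  obtain ⟨v, g⟩ := b
  rcases lt_trichotomy u v with h | rfl | h
  · rw [ordinalInf_of_lt h, ordinalInf_of_gt h]
  · simp [ordinalInf_same, Bool.and_comm]
  · rw [ordinalInf_of_gt h, ordinalInf_of_lt h]

theorem ordinalInf_assoc (a b c : Σ u, H u → Bool) :
    ordinalInf (ordinalInf a b) c = ordinalInf a (ordinalInf b c) := by
  obtain ⟨u, f⟩ := a
  obtain ⟨v, g⟩ := b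
  obtain ⟨w, k⟩ := c
  rcases lt_trichotomy u v with h | h | h <;> rcases lt_trichotomy v w with h' | h' | h'
  all_goals try subst h
  all_goals try subst h'
  · simp [ordinalInf_of_lt, h, h', h.trans h']
  · simp [ordinalInf_of_lt, ordinalInf_same, h]
  · simp [ordinalInf_of_lt, ordinalInf_of_gt, h, h']
  · simp [ordinalInf_of_lt, ordinalInf_same, h']
  · simp [ordinalInf_same, Bool.and_assoc]
  · simp [ordinalInf_of_gt, ordinalInf_same, h']
  · simp [ordinalInf_of_lt, ordinalInf_of_gt, h, h']
  · simp [ordinalInf_of_gt, ordinalInf_same, h]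
  · simp [ordinalInf_of_gt, h, h', h'.trans h]

theorem DURel.ordinalInf {a₁ b₁ c₁ a₂ b₂ c₂ : Σ u, H u → Bool}
    (h₁ : DURel a₁ b₁ c₁) (h₂ : DURel a₂ b₂ c₂) :
    DURel (ordinalInf a₁ a₂) (ordinalInf b₁ b₂) (ordinalInf c₁ c₂) := by
  obtain ⟨u, f, g, k, rfl, rfl, rfl, h₁⟩ := h₁
  obtain ⟨v, f', g', k', rfl, rfl, rfl, h₂⟩ := h₂
  rcases lt_trichotomy u v with h | rfl | h
  · simp only [ordinalInf_of_lt h]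
    exact ⟨u, f, g, k, rfl, rfl, rfl, h₁⟩
  · simp only [ordinalInf_same]
    refine ⟨u, _, _, _, rfl, rfl, rfl, fun i => ?_⟩
    simp only [SRel] at h₁ h₂ ⊢
    rw [h₁ i, h₂ i]
    ac_rfl
  · simp only [ordinalInf_of_gt h]
    exact ⟨v, f', g', k', rfl, rfl, rfl, h₂⟩

end OrdinalInf

/-- For any nonempty set `U` and any family of sets `(H u)_{u ∈ U}`, the disjoint union
`𝔾 = ⊔_{u ∈ U} 𝕊^{H u}` admits a binary polymorphism that is a semilattice operation on
its base set: idempotent, commutative and associative. -/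
theorem stmt12 {U : Type u} [Nonempty U] {H : U → Type v} :
    ∃ f : (Σ u, H u → Bool) → (Σ u, H u → Bool) → (Σ u, H u → Bool),
      (∀ a₁ b₁ c₁ a₂ b₂ c₂ : Σ u, H u → Bool,
        DURel a₁ b₁ c₁ → DURel a₂ b₂ c₂ → DURel (f a₁ a₂) (f b₁ b₂) (f c₁ c₂)) ∧
      (∀ a, f a a = a) ∧
      (∀ a b, f a b = f b a) ∧
      (∀ a b c, f (f a b) c = f a (f b c)) := by
  let _ : LinearOrder U := IsWellOrder.linearOrder WellOrderingRel
  exact ⟨ordinalInf, fun _ _ _ _ _ _ => DURel.ordinalInf, ordinalInf_self, ordinalInf_comm,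
    ordinalInf_assoc⟩
end
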